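/- arXiv:2412.13046 — 9 statements merged into one kernel-verified Lean document; each statement's English description precedes it below -/
import Mathlib

section
/- (Transient performance bound; abstract form of Theorem 1.) Assume the projected LMS setup. Let ℓ, s, V : ℕ → ℝ and constants K ≥ 0, C_J ≥ 0 be such that for all k ∈ ℕ, V (k+1) − V k + ℓ k ≤ s k + K·‖x̃ k + w k‖, and for all T ∈ ℕ, V 0 − V T ≤ C_J. Then for every T ≥ 1: ∑_{k=0}^{T−1} (ℓ k − s k) ≤ K·( 2·√T·√(∑_{k=0}^{T−1} ‖w k‖²) + √(T/μ)·‖θ̂ 0 − θ 0‖ + √(2·T·c_θ/μ)·∑_{k=0}^{T−1} √(‖θ (k+1) − θ k‖) ) + C_J. -/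
theorem proj_le_aux {F : Type*} [NormedAddCommGroup F] [InnerProductSpace ℝ F] {S : Set F}
    (hS : Convex ℝ S) {u v : F} (hv : v ∈ S) (h : ∀ η ∈ S, ‖v - u‖ ≤ ‖η - u‖) {p : F}
    (hp : p ∈ S) : ‖p - v‖ ^ 2 ≤ ‖p - u‖ ^ 2 := by
  have hne : Nonempty S := ⟨⟨v, hv⟩⟩
  have h1 : ‖u - v‖ = ⨅ w : S, ‖u - w‖ := by
    apply le_antisymm
    · apply le_ciInf
      intro w
      rw [norm_sub_rev u v, norm_sub_rev u]
      exact h w w.2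
    · exact ciInf_le (f := fun w : S => ‖u - w‖)
        ⟨0, by rintro _ ⟨w, rfl⟩; exact norm_nonneg _⟩ ⟨v, hv⟩
  have h2 := (norm_eq_iInf_iff_real_inner_le_zero hS hv).1 h1 p hp
  have h3 : p - u = (p - v) - (u - v) := by abel
  rw [h3, norm_sub_sq_real (p - v) (u - v), real_inner_comm]
  nlinarith [sq_nonneg ‖u - v‖]

theorem step_aux {F E : Type*} [NormedAddCommGroup F] [InnerProductSpace ℝ F] [CompleteSpace F]
    [NormedAddCommGroup E] [InnerProductSpace ℝ E] [CompleteSpace E] (G : F →L[ℝ] E) (μ : ℝ)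
    (hμ : 0 < μ) (hG : μ * ‖G‖ ^ 2 ≤ 1) (e : F) (w : E) :
    ‖e - μ • (ContinuousLinearMap.adjoint G) (G e + w)‖ ^ 2
      ≤ ‖e‖ ^ 2 - μ * ‖G e‖ ^ 2 + μ * ‖w‖ ^ 2 := by
  rw [norm_sub_sq_real, inner_smul_right, ContinuousLinearMap.adjoint_inner_right, norm_smul,
    Real.norm_of_nonneg hμ.le, inner_add_right, real_inner_self_eq_norm_sq]
  have h1 : ‖(ContinuousLinearMap.adjoint G) (G e + w)‖ ≤ ‖G‖ * ‖G e + w‖ := by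
    have := (ContinuousLinearMap.adjoint G).le_opNorm (G e + w)
    rwa [LinearIsometryEquiv.norm_map] at this
  have h2 : ‖(ContinuousLinearMap.adjoint G) (G e + w)‖ ^ 2 ≤ ‖G‖ ^ 2 * ‖G e + w‖ ^ 2 := by
    rw [← mul_pow]
    exact pow_le_pow_left₀ (norm_nonneg _) h1 2
  have h3 : μ * ‖(ContinuousLinearMap.adjoint G) (G e + w)‖ ^ 2 ≤ ‖G e + w‖ ^ 2 := by
    nlinarith [mul_le_mul_of_nonneg_left h2 hμ.le,
      mul_le_mul_of_nonneg_right hG (sq_nonneg ‖G e + w‖)]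
  have h4 := mul_le_mul_of_nonneg_left h3 hμ.le
  rw [norm_add_sq_real] at h4
  nlinarith

theorem sum_sqrt_aux (d : ℕ → ℝ) (hd : ∀ k, 0 ≤ d k) (T : ℕ) :
    ∑ k ∈ Finset.range T, d k ≤ (∑ k ∈ Finset.range T, Real.sqrt (d k)) ^ 2 := by
  induction T with
  | zero => simp
  | succ n ih =>
    rw [Finset.sum_range_succ, Finset.sum_range_succ]
    have h0 : 0 ≤ ∑ k ∈ Finset.range n, Real.sqrt (d k) :=
      Finset.sum_nonneg fun k _ => Real.sqrt_nonneg _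
    nlinarith [Real.sq_sqrt (hd n), mul_nonneg h0 (Real.sqrt_nonneg (d n))]

theorem cs_aux (f : ℕ → ℝ) (T : ℕ) (B : ℝ) (hB : 0 ≤ B)
    (h : ∑ k ∈ Finset.range T, f k ^ 2 ≤ B ^ 2) :
    ∑ k ∈ Finset.range T, f k ≤ Real.sqrt T * B := by
  refine (abs_le_of_sq_le_sq' ?_ (mul_nonneg (Real.sqrt_nonneg _) hB)).2
  have := sq_sum_le_card_mul_sum_sq (s := Finset.range T) (f := f)
  rw [Finset.card_range] at this
  rw [mul_pow, Real.sq_sqrt (Nat.cast_nonneg T)]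
  exact this.trans (mul_le_mul_of_nonneg_left h (Nat.cast_nonneg T))

/-- Transient performance bound (abstract form of Theorem 1). -/
theorem transient_performance_bound
    (n_x n_θ : ℕ) (hnx : 1 ≤ n_x) (hnθ : 1 ≤ n_θ)
    (Θ : Set (EuclideanSpace ℝ (Fin n_θ)))
    (hΘne : Θ.Nonempty) (hΘcpt : IsCompact Θ) (hΘconv : Convex ℝ Θ)
    (c_θ : ℝ) (hcθ : 0 ≤ c_θ)
    (hΘdiam : ∀ θ₁ ∈ Θ, ∀ θ₂ ∈ Θ, ‖θ₁ - θ₂‖ ≤ c_θ)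
    (μ : ℝ) (hμ : 0 < μ)
    (θ : ℕ → EuclideanSpace ℝ (Fin n_θ)) (hθ : ∀ k, θ k ∈ Θ)
    (G : ℕ → (EuclideanSpace ℝ (Fin n_θ) →L[ℝ] EuclideanSpace ℝ (Fin n_x)))
    (hG : ∀ k, μ * ‖G k‖ ^ 2 ≤ 1)
    (w : ℕ → EuclideanSpace ℝ (Fin n_x))
    (θhat : ℕ → EuclideanSpace ℝ (Fin n_θ)) (hθhat0 : θhat 0 ∈ Θ)
    (hmem : ∀ k, θhat (k + 1) ∈ Θ)
    (hproj : ∀ k, ∀ η ∈ Θ,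
      ‖θhat (k + 1) -
          (θhat k + μ • (ContinuousLinearMap.adjoint (G k)) ((G k) (θ k - θhat k) + w k))‖
        ≤ ‖η - (θhat k + μ • (ContinuousLinearMap.adjoint (G k)) ((G k) (θ k - θhat k) + w k))‖)
    (ℓ s V : ℕ → ℝ) (K C_J : ℝ) (hK : 0 ≤ K) (hCJ : 0 ≤ C_J)
    (hdesc : ∀ k : ℕ,
      V (k + 1) - V k + ℓ k ≤ s k + K * ‖(G k) (θ k - θhat k) + w k‖)
    (hVcost : ∀ T : ℕ, V 0 - V T ≤ C_J) :
    ∀ T : ℕ, 1 ≤ T →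
      ∑ k ∈ Finset.range T, (ℓ k - s k)
        ≤ K * (2 * Real.sqrt T * Real.sqrt (∑ k ∈ Finset.range T, ‖w k‖ ^ 2)
            + Real.sqrt (T / μ) * ‖θhat 0 - θ 0‖
            + Real.sqrt (2 * T * c_θ / μ)
                * ∑ k ∈ Finset.range T, Real.sqrt ‖θ (k + 1) - θ k‖)
          + C_J := by
  intro T _
  have hhat : ∀ k, θhat k ∈ Θ := by
    intro k
    cases k with
    | zero => exact hθhat0
    | succ n => exact hmem n
  have hstep : ∀ k, ‖θ (k + 1) - θhat (k + 1)‖ ^ 2 ≤ ‖θ k - θhat k‖ ^ 2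
      - μ * ‖G k (θ k - θhat k)‖ ^ 2 + μ * ‖w k‖ ^ 2 + 2 * c_θ * ‖θ (k + 1) - θ k‖ := by
    intro k
    have h1 := proj_le_aux hΘconv (hmem k) (hproj k) (hθ k)
    have h2 := step_aux (G k) μ hμ (hG k) (θ k - θhat k) (w k)
    rw [← sub_sub] at h1
    have h3 : ‖θ (k + 1) - θhat (k + 1)‖ ≤ ‖θ (k + 1) - θ k‖ + ‖θ k - θhat (k + 1)‖ :=
      norm_sub_le_norm_sub_add_norm_sub _ _ _
    have h4 := hΘdiam _ (hθ (k + 1)) _ (hmem k)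
    have h5 := hΘdiam _ (hθ k) _ (hmem k)
    have h6 : ‖θ (k + 1) - θhat (k + 1)‖ ^ 2 ≤ ‖θ k - θhat (k + 1)‖ ^ 2
        + 2 * c_θ * ‖θ (k + 1) - θ k‖ := by
      have ha := norm_nonneg (θ (k + 1) - θhat (k + 1))
      have hb := norm_nonneg (θ k - θhat (k + 1))
      have hd := norm_nonneg (θ (k + 1) - θ k)
      generalize ‖θ (k + 1) - θhat (k + 1)‖ = a at *
      generalize ‖θ k - θhat (k + 1)‖ = b at *
      generalize ‖θ (k + 1) - θ k‖ = d at *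
      nlinarith [mul_nonneg (sub_nonneg.2 h3) (add_nonneg ha hb),
        mul_nonneg hd (sub_nonneg.2 (add_le_add h4 h5))]
    linarith
  have hsum : ∀ N : ℕ, μ * ∑ k ∈ Finset.range N, ‖G k (θ k - θhat k)‖ ^ 2
      + ‖θ N - θhat N‖ ^ 2
      ≤ ‖θ 0 - θhat 0‖ ^ 2 + μ * ∑ k ∈ Finset.range N, ‖w k‖ ^ 2
        + 2 * c_θ * ∑ k ∈ Finset.range N, ‖θ (k + 1) - θ k‖ := by
    intro N
    induction N with
    | zero => simp
    | succ n ih =>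
      simp only [Finset.sum_range_succ, mul_add]
      linarith [hstep n]
  have htel : ∀ N : ℕ, ∑ k ∈ Finset.range N, (ℓ k - s k)
      ≤ K * ∑ k ∈ Finset.range N, ‖G k (θ k - θhat k) + w k‖ + (V 0 - V N) := by
    intro N
    induction N with
    | zero => simp
    | succ n ih =>
      simp only [Finset.sum_range_succ, mul_add]
      linarith [hdesc n]
  set W := ∑ k ∈ Finset.range T, ‖w k‖ ^ 2 with hW
  set D := ∑ k ∈ Finset.range T, Real.sqrt ‖θ (k + 1) - θ k‖ with hD
  have hW0 : 0 ≤ W := Finset.sum_nonneg fun k _ => sq_nonneg _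
  have hD0 : 0 ≤ D := Finset.sum_nonneg fun k _ => Real.sqrt_nonneg _
  have hDD : ∑ k ∈ Finset.range T, ‖θ (k + 1) - θ k‖ ≤ D ^ 2 :=
    sum_sqrt_aux _ (fun k => norm_nonneg _) T
  have hx : ∑ k ∈ Finset.range T, ‖G k (θ k - θhat k)‖ ≤ Real.sqrt T *
      (Real.sqrt W + Real.sqrt (1 / μ) * ‖θhat 0 - θ 0‖ + Real.sqrt (2 * c_θ / μ) * D) := by
    have p1 : 0 ≤ Real.sqrt W := Real.sqrt_nonneg _
    have p2 : 0 ≤ Real.sqrt (1 / μ) * ‖θhat 0 - θ 0‖ := by positivity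
    have p3 : 0 ≤ Real.sqrt (2 * c_θ / μ) * D := by positivity
    apply cs_aux _ _ _ (by positivity)
    have q1 : Real.sqrt W ^ 2 = W := Real.sq_sqrt hW0
    have q2 : (Real.sqrt (1 / μ) * ‖θhat 0 - θ 0‖) ^ 2 = 1 / μ * ‖θhat 0 - θ 0‖ ^ 2 := by
      rw [mul_pow, Real.sq_sqrt (by positivity)]
    have q3 : (Real.sqrt (2 * c_θ / μ) * D) ^ 2 = 2 * c_θ / μ * D ^ 2 := by
      rw [mul_pow, Real.sq_sqrt (by positivity)]
    have q4 : ∑ k ∈ Finset.range T, ‖G k (θ k - θhat k)‖ ^ 2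
        ≤ W + 1 / μ * ‖θhat 0 - θ 0‖ ^ 2 + 2 * c_θ / μ * D ^ 2 := by
      have e : W + 1 / μ * ‖θhat 0 - θ 0‖ ^ 2 + 2 * c_θ / μ * D ^ 2
          = (‖θhat 0 - θ 0‖ ^ 2 + μ * W + 2 * c_θ * D ^ 2) / μ := by
        field_simp
        ring
      rw [e, le_div_iff₀ hμ, norm_sub_rev]
      have := mul_le_mul_of_nonneg_left hDD (by positivity : 0 ≤ 2 * c_θ)
      nlinarith [hsum T, sq_nonneg ‖θ T - θhat T‖]
    nlinarith [mul_nonneg p1 p2, mul_nonneg p1 p3, mul_nonneg p2 p3]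
  have hw : ∑ k ∈ Finset.range T, ‖w k‖ ≤ Real.sqrt T * Real.sqrt W :=
    cs_aux _ _ _ (Real.sqrt_nonneg _) (Real.sq_sqrt hW0).ge
  have hxw : ∑ k ∈ Finset.range T, ‖G k (θ k - θhat k) + w k‖
      ≤ ∑ k ∈ Finset.range T, ‖G k (θ k - θhat k)‖ + ∑ k ∈ Finset.range T, ‖w k‖ := by
    rw [← Finset.sum_add_distrib]
    exact Finset.sum_le_sum fun k _ => norm_add_le _ _
  have r1 : Real.sqrt (T / μ) = Real.sqrt T * Real.sqrt (1 / μ) := by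
    rw [← Real.sqrt_mul (Nat.cast_nonneg T)]
    congr 1
    ring
  have r2 : Real.sqrt (2 * T * c_θ / μ) = Real.sqrt T * Real.sqrt (2 * c_θ / μ) := by
    rw [← Real.sqrt_mul (Nat.cast_nonneg T)]
    congr 1
    ring
  refine (htel T).trans (add_le_add (mul_le_mul_of_nonneg_left ?_ hK) (hVcost T))
  rw [r1, r2]
  linarith
end

section
/- (Cumulative prediction-error bound; Proposition 1, inequality (15a).) Assume the projected LMS setup. Then for every T ∈ ℕ: ∑_{k=0}^{T} ‖x̃ k‖² ≤ (1/μ)·‖θ̂ 0 − θ 0‖² + ∑_{k=0}^{T} ( ‖w k‖² + (2·c_θ/μ)·‖θ (k+1) − θ k‖ ). -/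
/-- Moving to the metric projection does not increase the distance to points of the set. -/
theorem proj_dist_le {F : Type*} [NormedAddCommGroup F] [InnerProductSpace ℝ F]
    {K : Set F} (hK : Convex ℝ K) {u v z : F} (hv : v ∈ K) (hz : z ∈ K)
    (h : ∀ η ∈ K, ‖v - u‖ ≤ ‖η - u‖) : ‖v - z‖ ^ 2 ≤ ‖u - z‖ ^ 2 := by
  have hinf : ‖u - v‖ = ⨅ y : K, ‖u - y‖ := by
    haveI : Nonempty K := ⟨⟨v, hv⟩⟩
    apply le_antisymm
    · apply le_ciInf
      intro y
      rw [norm_sub_rev u v, norm_sub_rev u y]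
      exact h y y.2
    · exact ciInf_le (f := fun y : K => ‖u - y‖)
        ⟨0, by rintro _ ⟨y, rfl⟩; exact norm_nonneg _⟩ ⟨v, hv⟩
  have h1 := (norm_eq_iInf_iff_real_inner_le_zero hK hv).1 hinf z hz
  have h2 : u - z = (u - v) - (z - v) := by abel
  rw [h2, norm_sub_sq_real (u - v), norm_sub_rev v z]
  nlinarith [sq_nonneg ‖u - v‖]

/-- One unprojected LMS step. -/
theorem lms_step {E F : Type*} [NormedAddCommGroup E] [InnerProductSpace ℝ E] [CompleteSpace E]
    [NormedAddCommGroup F] [InnerProductSpace ℝ F] [CompleteSpace F]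
    (G : F →L[ℝ] E) (μ : ℝ) (hμ : 0 < μ) (hG : μ * ‖G‖ ^ 2 ≤ 1) (t s : F) (w : E) :
    ‖s + μ • (ContinuousLinearMap.adjoint G) (G (t - s) + w) - t‖ ^ 2
      ≤ ‖s - t‖ ^ 2 + μ * (‖w‖ ^ 2 - ‖G (t - s)‖ ^ 2) := by
  have h2 : s + μ • (ContinuousLinearMap.adjoint G) (G (t - s) + w) - t
      = μ • (ContinuousLinearMap.adjoint G) (G (t - s) + w) - (t - s) := by abel
  have h3 : ‖(ContinuousLinearMap.adjoint G) (G (t - s) + w)‖ ≤ ‖G‖ * ‖G (t - s) + w‖ := by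
    have := (ContinuousLinearMap.adjoint G).le_opNorm (G (t - s) + w)
    rwa [LinearIsometryEquiv.norm_map] at this
  have h4 : μ * ‖(ContinuousLinearMap.adjoint G) (G (t - s) + w)‖ ^ 2
      ≤ ‖G (t - s) + w‖ ^ 2 := by
    have h5 := pow_le_pow_left₀ (norm_nonneg _) h3 2
    rw [mul_pow] at h5
    have h6 := mul_le_mul_of_nonneg_left h5 hμ.le
    have h7 := mul_le_mul_of_nonneg_right hG (sq_nonneg ‖G (t - s) + w‖)
    linarith
  have h8 := mul_le_mul_of_nonneg_left h4 hμ.le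
  rw [h2, norm_sub_sq_real, norm_sub_rev s t, norm_smul, mul_pow, Real.norm_eq_abs, sq_abs,
    real_inner_smul_left, ContinuousLinearMap.adjoint_inner_left, inner_add_left,
    real_inner_self_eq_norm_sq, real_inner_comm]
  rw [norm_add_sq_real] at h8
  nlinarith

/-- Cumulative prediction-error bound for the projected least-mean-squares estimator
(Proposition 1, inequality (15a)). -/
theorem lms_cumulative_prediction_error_bound
    (n_x n_θ : ℕ) (hnx : 1 ≤ n_x) (hnθ : 1 ≤ n_θ)
    (Θ : Set (EuclideanSpace ℝ (Fin n_θ)))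
    (hΘne : Θ.Nonempty) (hΘcpt : IsCompact Θ) (hΘconv : Convex ℝ Θ)
    (c_θ : ℝ) (hcθ : 0 ≤ c_θ)
    (hΘdiam : ∀ θ₁ ∈ Θ, ∀ θ₂ ∈ Θ, ‖θ₁ - θ₂‖ ≤ c_θ)
    (μ : ℝ) (hμ : 0 < μ)
    (θ : ℕ → EuclideanSpace ℝ (Fin n_θ)) (hθ : ∀ k, θ k ∈ Θ)
    (G : ℕ → (EuclideanSpace ℝ (Fin n_θ) →L[ℝ] EuclideanSpace ℝ (Fin n_x)))
    (hG : ∀ k, μ * ‖G k‖ ^ 2 ≤ 1)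
    (w : ℕ → EuclideanSpace ℝ (Fin n_x))
    (θhat : ℕ → EuclideanSpace ℝ (Fin n_θ)) (hθhat0 : θhat 0 ∈ Θ)
    (hmem : ∀ k, θhat (k + 1) ∈ Θ)
    (hproj : ∀ k, ∀ η ∈ Θ,
      ‖θhat (k + 1) -
          (θhat k + μ • (ContinuousLinearMap.adjoint (G k)) ((G k) (θ k - θhat k) + w k))‖
        ≤ ‖η - (θhat k + μ • (ContinuousLinearMap.adjoint (G k)) ((G k) (θ k - θhat k) + w k))‖) :
    ∀ T : ℕ,
      ∑ k ∈ Finset.range (T + 1), ‖(G k) (θ k - θhat k)‖ ^ 2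
        ≤ (1 / μ) * ‖θhat 0 - θ 0‖ ^ 2
          + ∑ k ∈ Finset.range (T + 1),
              (‖w k‖ ^ 2 + (2 * c_θ / μ) * ‖θ (k + 1) - θ k‖) := by
  have key : ∀ k, μ * ‖(G k) (θ k - θhat k)‖ ^ 2 + ‖θhat (k + 1) - θ (k + 1)‖ ^ 2
      ≤ ‖θhat k - θ k‖ ^ 2 + μ * ‖w k‖ ^ 2 + 2 * c_θ * ‖θ (k + 1) - θ k‖ := by
    intro k
    have h1 := proj_dist_le hΘconv (hmem k) (hθ k) (hproj k)
    have h2 := lms_step (G k) μ hμ (hG k) (θ k) (θhat k) (w k)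
    have h3 : θhat (k + 1) - θ k = (θhat (k + 1) - θ (k + 1)) + (θ (k + 1) - θ k) := by abel
    rw [h3, norm_add_sq_real] at h1
    have h4 := abs_le.1 (abs_real_inner_le_norm (θhat (k + 1) - θ (k + 1)) (θ (k + 1) - θ k))
    have h5 := mul_le_mul_of_nonneg_right (hΘdiam _ (hmem k) _ (hθ (k + 1)))
      (norm_nonneg (θ (k + 1) - θ k))
    nlinarith [sq_nonneg ‖θ (k + 1) - θ k‖, h4.1]
  have key2 : ∀ k, ‖(G k) (θ k - θhat k)‖ ^ 2 + (1 / μ) * ‖θhat (k + 1) - θ (k + 1)‖ ^ 2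
      ≤ (1 / μ) * ‖θhat k - θ k‖ ^ 2 + (‖w k‖ ^ 2 + (2 * c_θ / μ) * ‖θ (k + 1) - θ k‖) := by
    intro k
    have h := mul_le_mul_of_nonneg_left (key k) (one_div_pos.2 hμ).le
    have hi : 1 / μ * μ = 1 := one_div_mul_cancel hμ.ne'
    have e : 2 * c_θ / μ = 1 / μ * (2 * c_θ) := by ring
    rw [e]
    simp only [mul_add, ← mul_assoc, hi, one_mul] at h ⊢
    linarith
  have main : ∀ T : ℕ, ∑ k ∈ Finset.range T, ‖(G k) (θ k - θhat k)‖ ^ 2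
        + (1 / μ) * ‖θhat T - θ T‖ ^ 2
        ≤ (1 / μ) * ‖θhat 0 - θ 0‖ ^ 2
          + ∑ k ∈ Finset.range T,
              (‖w k‖ ^ 2 + (2 * c_θ / μ) * ‖θ (k + 1) - θ k‖) := by
    intro T
    induction T with
    | zero => simp
    | succ T ih =>
      rw [Finset.sum_range_succ, Finset.sum_range_succ]
      linarith [key2 T]
  intro T
  have h : 0 ≤ (1 / μ) * ‖θhat (T + 1) - θ (T + 1)‖ ^ 2 := by positivity
  linarith [main (T + 1)]
end

section
/- (Per-step LMS descent; inequality (48) in the proof of Proposition 1.) Let E = EuclideanSpace ℝ (Fin n_x) and Pθ = EuclideanSpace ℝ (Fin n_θ), let μ > 0, and let G : Pθ →L[ℝ] E be a continuous linear map with μ·‖G‖² ≤ 1 (operator norm). Let θ, θ̂ ∈ Pθ and w ∈ E, and set x̃ := G (θ − θ̂) and θ̃' := θ̂ + μ • G.adjoint (x̃ + w). Then (1/μ)·‖θ̃' − θ‖² − (1/μ)·‖θ̂ − θ‖² ≤ −‖x̃‖² + ‖w‖². -/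
/-- Per-step LMS descent inequality (inequality (48) in the proof of Proposition 1). -/
theorem lms_per_step_descent
    (n_x n_θ : ℕ) (hnx : 1 ≤ n_x) (hnθ : 1 ≤ n_θ)
    (μ : ℝ) (hμ : 0 < μ)
    (G : EuclideanSpace ℝ (Fin n_θ) →L[ℝ] EuclideanSpace ℝ (Fin n_x))
    (hG : μ * ‖G‖ ^ 2 ≤ 1)
    (θ θhat : EuclideanSpace ℝ (Fin n_θ)) (w : EuclideanSpace ℝ (Fin n_x)) :
    (1 / μ) * ‖(θhat + μ • (ContinuousLinearMap.adjoint G) (G (θ - θhat) + w)) - θ‖ ^ 2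
        - (1 / μ) * ‖θhat - θ‖ ^ 2
      ≤ -‖G (θ - θhat)‖ ^ 2 + ‖w‖ ^ 2 := by
  set d := θ - θhat with hd
  set e := G d + w with he
  set A := ContinuousLinearMap.adjoint G with hA
  have h1 : (θhat + μ • A e) - θ = μ • A e - d := by rw [hd]; abel
  have h2 : ‖θhat - θ‖ = ‖d‖ := by rw [hd, norm_sub_rev]
  have h3 : ‖μ • A e - d‖ ^ 2 = μ ^ 2 * ‖A e‖ ^ 2 - 2 * (μ * inner ℝ e (G d)) + ‖d‖ ^ 2 := by
    rw [norm_sub_sq_real, norm_smul, real_inner_smul_left, hA,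
      ContinuousLinearMap.adjoint_inner_left, mul_pow, Real.norm_eq_abs, sq_abs]
  have h4 : ‖A e‖ ≤ ‖G‖ * ‖e‖ := by
    have h := A.le_opNorm e
    rwa [hA, LinearIsometryEquiv.norm_map] at h
  have h5 : μ * ‖A e‖ ^ 2 ≤ ‖e‖ ^ 2 := by
    calc μ * ‖A e‖ ^ 2 ≤ μ * (‖G‖ * ‖e‖) ^ 2 := by gcongr
      _ = (μ * ‖G‖ ^ 2) * ‖e‖ ^ 2 := by ring
      _ ≤ 1 * ‖e‖ ^ 2 := by gcongr
      _ = ‖e‖ ^ 2 := one_mul _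
  have h6 : ‖w‖ ^ 2 = ‖e‖ ^ 2 - 2 * inner ℝ e (G d) + ‖G d‖ ^ 2 := by
    rw [← norm_sub_sq_real, he, add_sub_cancel_left]
  have h7 : (1 / μ) * (μ ^ 2 * ‖A e‖ ^ 2 - 2 * (μ * inner ℝ e (G d)) + ‖d‖ ^ 2)
      - (1 / μ) * ‖d‖ ^ 2 = μ * ‖A e‖ ^ 2 - 2 * inner ℝ e (G d) := by
    field_simp
    ring
  rw [h1, h2, h3, h7, h6]
  linarith
end

section
/- (Lemma 2: asymptotic average of one-step prediction error.) Assume the projected LMS setup. Suppose there exist finite constants S_w and S_θ such that ∑_{k=0}^{T} ‖w k‖² ≤ S_w and ∑_{k=0}^{T} ‖θ (k+1) − θ k‖ ≤ S_θ for all T ∈ ℕ. Then lim_{T→∞} (1/T)·∑_{k=0}^{T−1} ( ‖x̃ k‖ + ‖w k‖ ) = 0. -/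
/-- The metric projection onto a convex set does not increase distances to its points. -/
theorem proj_dist_le_aux {F : Type*} [NormedAddCommGroup F] [InnerProductSpace ℝ F]
    {K : Set F} (hK : Convex ℝ K) {u v p : F} (hv : v ∈ K) (hp : p ∈ K)
    (h : ∀ η ∈ K, ‖v - u‖ ≤ ‖η - u‖) : ‖p - v‖ ^ 2 ≤ ‖p - u‖ ^ 2 := by
  have hinf : ‖u - v‖ = ⨅ w : K, ‖u - w‖ := by
    haveI : Nonempty K := ⟨⟨v, hv⟩⟩
    apply le_antisymm
    · apply le_ciInf
      intro η
      rw [norm_sub_rev u v, norm_sub_rev u]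
      exact h η η.2
    · exact ciInf_le (f := fun w : K => ‖u - w‖)
        ⟨0, by rintro _ ⟨w, rfl⟩; exact norm_nonneg _⟩ ⟨v, hv⟩
  have h1 := (norm_eq_iInf_iff_real_inner_le_zero hK hv).1 hinf p hp
  have h2 : p - u = (p - v) - (u - v) := by abel
  rw [h2, norm_sub_sq_real (p - v) (u - v), real_inner_comm]
  nlinarith [sq_nonneg ‖u - v‖]

/-- One gradient step. -/
theorem grad_step_aux {F H : Type*} [NormedAddCommGroup F] [InnerProductSpace ℝ F] [CompleteSpace F]
    [NormedAddCommGroup H] [InnerProductSpace ℝ H] [CompleteSpace H]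
    (G : F →L[ℝ] H) (μ : ℝ) (hμ : 0 < μ) (hG : μ * ‖G‖ ^ 2 ≤ 1) (e : F) (w : H) :
    ‖e - μ • (ContinuousLinearMap.adjoint G) (G e + w)‖ ^ 2
      ≤ ‖e‖ ^ 2 + μ * (‖w‖ ^ 2 - ‖G e‖ ^ 2) := by
  have h1 : ‖(ContinuousLinearMap.adjoint G) (G e + w)‖ ≤ ‖G‖ * ‖G e + w‖ := by
    have := (ContinuousLinearMap.adjoint G).le_opNorm (G e + w)
    rwa [LinearIsometryEquiv.norm_map] at this
  have h2 : ‖(ContinuousLinearMap.adjoint G) (G e + w)‖ ^ 2 ≤ ‖G‖ ^ 2 * ‖G e + w‖ ^ 2 := by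
    rw [← mul_pow]
    exact pow_le_pow_left₀ (norm_nonneg _) h1 2
  have h3 : μ ^ 2 * ‖(ContinuousLinearMap.adjoint G) (G e + w)‖ ^ 2 ≤ μ * ‖G e + w‖ ^ 2 := by
    calc _ ≤ μ ^ 2 * (‖G‖ ^ 2 * ‖G e + w‖ ^ 2) := by gcongr
      _ = (μ * ‖G‖ ^ 2) * (μ * ‖G e + w‖ ^ 2) := by ring
      _ ≤ 1 * (μ * ‖G e + w‖ ^ 2) := by gcongr
      _ = _ := one_mul _
  have h4 : ‖G e + w‖ ^ 2 = ‖G e‖ ^ 2 + 2 * inner ℝ (G e) w + ‖w‖ ^ 2 := norm_add_sq_real _ _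
  rw [norm_sub_sq_real, real_inner_smul_right, ContinuousLinearMap.adjoint_inner_right,
    inner_add_right, real_inner_self_eq_norm_sq, norm_smul, mul_pow, Real.norm_eq_abs, sq_abs]
  rw [h4] at h3
  linarith

/-- Bounded sums of squares give a null sequence. -/
theorem null_of_sq_aux (a : ℕ → ℝ) (ha : ∀ k, 0 ≤ a k) (C : ℝ)
    (h : ∀ T : ℕ, ∑ k ∈ Finset.range T, a k ^ 2 ≤ C) :
    Filter.Tendsto a Filter.atTop (nhds 0) := by
  have h1 := (summable_of_sum_range_le (fun k => sq_nonneg (a k)) h).tendsto_atTop_zero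
  have h2 := h1.sqrt
  simpa [Real.sqrt_sq (ha _)] using h2

/-- Lemma 2: the asymptotic average of the one-step prediction error is zero. -/
theorem lms_asymptotic_average_prediction_error
    (n_x n_θ : ℕ) (hnx : 1 ≤ n_x) (hnθ : 1 ≤ n_θ)
    (Θ : Set (EuclideanSpace ℝ (Fin n_θ)))
    (hΘne : Θ.Nonempty) (hΘcpt : IsCompact Θ) (hΘconv : Convex ℝ Θ)
    (c_θ : ℝ) (hcθ : 0 ≤ c_θ)
    (hΘdiam : ∀ θ₁ ∈ Θ, ∀ θ₂ ∈ Θ, ‖θ₁ - θ₂‖ ≤ c_θ)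
    (μ : ℝ) (hμ : 0 < μ)
    (θ : ℕ → EuclideanSpace ℝ (Fin n_θ)) (hθ : ∀ k, θ k ∈ Θ)
    (G : ℕ → (EuclideanSpace ℝ (Fin n_θ) →L[ℝ] EuclideanSpace ℝ (Fin n_x)))
    (hG : ∀ k, μ * ‖G k‖ ^ 2 ≤ 1)
    (w : ℕ → EuclideanSpace ℝ (Fin n_x))
    (θhat : ℕ → EuclideanSpace ℝ (Fin n_θ)) (hθhat0 : θhat 0 ∈ Θ)
    (hmem : ∀ k, θhat (k + 1) ∈ Θ)
    (hproj : ∀ k, ∀ η ∈ Θ,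
      ‖θhat (k + 1) -
          (θhat k + μ • (ContinuousLinearMap.adjoint (G k)) ((G k) (θ k - θhat k) + w k))‖
        ≤ ‖η - (θhat k + μ • (ContinuousLinearMap.adjoint (G k)) ((G k) (θ k - θhat k) + w k))‖)
    (S_w S_θ : ℝ)
    (hSw : ∀ T : ℕ, ∑ k ∈ Finset.range (T + 1), ‖w k‖ ^ 2 ≤ S_w)
    (hSθ : ∀ T : ℕ, ∑ k ∈ Finset.range (T + 1), ‖θ (k + 1) - θ k‖ ≤ S_θ) :
    Filter.Tendsto
      (fun T : ℕ =>
        (1 / (T : ℝ)) * ∑ k ∈ Finset.range T, (‖(G k) (θ k - θhat k)‖ + ‖w k‖))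
      Filter.atTop (nhds 0) := by
  have hhat : ∀ k, θhat k ∈ Θ := by
    intro k
    cases k with
    | zero => exact hθhat0
    | succ k => exact hmem k
  have key : ∀ k, μ * ‖(G k) (θ k - θhat k)‖ ^ 2 ≤
      ‖θ k - θhat k‖ ^ 2 - ‖θ (k + 1) - θhat (k + 1)‖ ^ 2 + μ * ‖w k‖ ^ 2
        + 2 * c_θ * ‖θ (k + 1) - θ k‖ := by
    intro k
    have h1 := proj_dist_le_aux hΘconv (hmem k) (hθ k) (hproj k)
    have h2 := grad_step_aux (G k) μ hμ (hG k) (θ k - θhat k) (w k)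
    rw [← sub_sub] at h1
    have ha := hΘdiam _ (hθ (k + 1)) _ (hmem k)
    have hb := hΘdiam _ (hθ k) _ (hmem k)
    have hab : ‖θ (k + 1) - θhat (k + 1)‖ ≤ ‖θ (k + 1) - θ k‖ + ‖θ k - θhat (k + 1)‖ :=
      norm_sub_le_norm_sub_add_norm_sub _ _ _
    have hd := norm_nonneg (θ (k + 1) - θ k)
    have ha0 := norm_nonneg (θ (k + 1) - θhat (k + 1))
    have hb0 := norm_nonneg (θ k - θhat (k + 1))
    have h3 : ‖θ (k + 1) - θhat (k + 1)‖ ^ 2 - ‖θ k - θhat (k + 1)‖ ^ 2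
        ≤ 2 * c_θ * ‖θ (k + 1) - θ k‖ := by
      generalize ‖θ (k + 1) - θhat (k + 1)‖ = a at *
      generalize ‖θ k - θhat (k + 1)‖ = b at *
      generalize ‖θ (k + 1) - θ k‖ = d at *
      calc a ^ 2 - b ^ 2 = (a + b) * (a - b) := by ring
        _ ≤ (a + b) * d := mul_le_mul_of_nonneg_left (by linarith) (by linarith)
        _ ≤ 2 * c_θ * d := mul_le_mul_of_nonneg_right (by linarith) hd
    linarith
  have sumkey : ∀ T : ℕ, μ * ∑ k ∈ Finset.range T, ‖(G k) (θ k - θhat k)‖ ^ 2 ≤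
      ‖θ 0 - θhat 0‖ ^ 2 - ‖θ T - θhat T‖ ^ 2 + μ * ∑ k ∈ Finset.range T, ‖w k‖ ^ 2
        + 2 * c_θ * ∑ k ∈ Finset.range T, ‖θ (k + 1) - θ k‖ := by
    intro T
    induction T with
    | zero => simp
    | succ T ih =>
      simp only [Finset.sum_range_succ, mul_add]
      linarith [key T]
  have hSw' : ∀ T : ℕ, ∑ k ∈ Finset.range T, ‖w k‖ ^ 2 ≤ S_w := by
    intro T
    have := hSw T
    rw [Finset.sum_range_succ] at this
    linarith [sq_nonneg ‖w T‖]
  have hSθ' : ∀ T : ℕ, ∑ k ∈ Finset.range T, ‖θ (k + 1) - θ k‖ ≤ S_θ := by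
    intro T
    have := hSθ T
    rw [Finset.sum_range_succ] at this
    linarith [norm_nonneg (θ (T + 1) - θ T)]
  have hx : ∀ T : ℕ, ∑ k ∈ Finset.range T, ‖(G k) (θ k - θhat k)‖ ^ 2 ≤
      (‖θ 0 - θhat 0‖ ^ 2 + μ * S_w + 2 * c_θ * S_θ) / μ := by
    intro T
    rw [le_div_iff₀ hμ, mul_comm]
    have h1 := mul_le_mul_of_nonneg_left (hSw' T) hμ.le
    have h2 := mul_le_mul_of_nonneg_left (hSθ' T) (by positivity : 0 ≤ 2 * c_θ)
    linarith [sumkey T, sq_nonneg ‖θ T - θhat T‖]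
  have t1 := null_of_sq_aux _ (fun k => norm_nonneg ((G k) (θ k - θhat k))) _ hx
  have t2 := null_of_sq_aux _ (fun k => norm_nonneg (w k)) _ hSw'
  have t3 := (t1.add t2).cesaro
  simpa only [one_div, add_zero] using t3
end

section
/- (Lemma 3: accumulated disturbance and prediction error.) Assume the projected LMS setup. Then for every T ≥ 1: (i) ∑_{k=0}^{T−1} ‖w k‖ ≤ √T · √(∑_{k=0}^{T−1} ‖w k‖²); and (ii) ∑_{k=0}^{T−1} ‖x̃ k‖ ≤ √T·√(∑_{k=0}^{T−1} ‖w k‖²) + √(T/μ)·‖θ̂ 0 − θ 0‖ + √(2·T·c_θ/μ)·∑_{k=0}^{T−1} √(‖θ (k+1) − θ k‖). -/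
theorem proj_step_aux {E : Type*} [NormedAddCommGroup E] [InnerProductSpace ℝ E]
    (K : Set E) (hK : Convex ℝ K) (y p q : E) (hp : p ∈ K) (hq : q ∈ K)
    (h : ∀ η ∈ K, ‖p - y‖ ≤ ‖η - y‖) : ‖q - p‖ ^ 2 ≤ ‖q - y‖ ^ 2 := by
  have h1 : ‖y - p‖ = ⨅ z : K, ‖y - z‖ := by
    haveI : Nonempty K := ⟨⟨p, hp⟩⟩
    apply le_antisymm
    · apply le_ciInf
      intro z
      rw [norm_sub_rev y p, norm_sub_rev y z]
      exact h z z.2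
    · exact ciInf_le (f := fun z : K => ‖y - z‖)
        ⟨0, by rintro _ ⟨z, rfl⟩; exact norm_nonneg _⟩ ⟨p, hp⟩
  have h2 := (norm_eq_iInf_iff_real_inner_le_zero hK hp).1 h1 q hq
  have h3 : q - y = (q - p) - (y - p) := by abel
  rw [h3, norm_sub_sq_real (q - p) (y - p), real_inner_comm]
  nlinarith [sq_nonneg ‖y - p‖]

theorem sum_le_sqrt_aux (T : ℕ) (f : ℕ → ℝ) :
    ∑ k ∈ Finset.range T, f k
      ≤ Real.sqrt T * Real.sqrt (∑ k ∈ Finset.range T, f k ^ 2) := by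
  rw [← Real.sqrt_mul (Nat.cast_nonneg T)]
  apply Real.le_sqrt_of_sq_le
  simpa using sq_sum_le_card_mul_sum_sq (s := Finset.range T) (f := f)

theorem lms_step_aux {E F : Type*} [NormedAddCommGroup E] [InnerProductSpace ℝ E]
    [CompleteSpace E] [NormedAddCommGroup F] [InnerProductSpace ℝ F] [CompleteSpace F]
    (G : E →L[ℝ] F) (μ : ℝ) (hμ : 0 < μ) (hG : μ * ‖G‖ ^ 2 ≤ 1) (e : E) (w : F) :
    ‖e - μ • (ContinuousLinearMap.adjoint G) (G e + w)‖ ^ 2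
      ≤ ‖e‖ ^ 2 - μ * ‖G e‖ ^ 2 + μ * ‖w‖ ^ 2 := by
  rw [norm_sub_sq_real, inner_smul_right, ContinuousLinearMap.adjoint_inner_right,
    inner_add_right, real_inner_self_eq_norm_sq, norm_smul, Real.norm_of_nonneg hμ.le]
  have h1 : ‖(ContinuousLinearMap.adjoint G) (G e + w)‖ ≤ ‖G‖ * ‖G e + w‖ := by
    have := (ContinuousLinearMap.adjoint G).le_opNorm (G e + w)
    rwa [LinearIsometryEquiv.norm_map] at this
  have h2 : ‖(ContinuousLinearMap.adjoint G) (G e + w)‖ ^ 2 ≤ ‖G‖ ^ 2 * ‖G e + w‖ ^ 2 := by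
    rw [← mul_pow]
    exact pow_le_pow_left₀ (norm_nonneg _) h1 2
  have h3 := norm_add_sq_real (G e) w
  have h4 : μ * (μ * ‖(ContinuousLinearMap.adjoint G) (G e + w)‖ ^ 2) ≤ μ * ‖G e + w‖ ^ 2 := by
    apply mul_le_mul_of_nonneg_left _ hμ.le
    calc _ ≤ μ * (‖G‖ ^ 2 * ‖G e + w‖ ^ 2) := mul_le_mul_of_nonneg_left h2 hμ.le
      _ = (μ * ‖G‖ ^ 2) * ‖G e + w‖ ^ 2 := by ring
      _ ≤ 1 * ‖G e + w‖ ^ 2 := mul_le_mul_of_nonneg_right hG (sq_nonneg _)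
      _ = _ := one_mul _
  rw [h3] at h4
  nlinarith

/-- Lemma 3: accumulated disturbance and prediction error. -/
theorem lms_accumulated_disturbance_and_prediction_error
    (n_x n_θ : ℕ) (hnx : 1 ≤ n_x) (hnθ : 1 ≤ n_θ)
    (Θ : Set (EuclideanSpace ℝ (Fin n_θ)))
    (hΘne : Θ.Nonempty) (hΘcpt : IsCompact Θ) (hΘconv : Convex ℝ Θ)
    (c_θ : ℝ) (hcθ : 0 ≤ c_θ)
    (hΘdiam : ∀ θ₁ ∈ Θ, ∀ θ₂ ∈ Θ, ‖θ₁ - θ₂‖ ≤ c_θ)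
    (μ : ℝ) (hμ : 0 < μ)
    (θ : ℕ → EuclideanSpace ℝ (Fin n_θ)) (hθ : ∀ k, θ k ∈ Θ)
    (G : ℕ → (EuclideanSpace ℝ (Fin n_θ) →L[ℝ] EuclideanSpace ℝ (Fin n_x)))
    (hG : ∀ k, μ * ‖G k‖ ^ 2 ≤ 1)
    (w : ℕ → EuclideanSpace ℝ (Fin n_x))
    (θhat : ℕ → EuclideanSpace ℝ (Fin n_θ)) (hθhat0 : θhat 0 ∈ Θ)
    (hmem : ∀ k, θhat (k + 1) ∈ Θ)
    (hproj : ∀ k, ∀ η ∈ Θ,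
      ‖θhat (k + 1) -
          (θhat k + μ • (ContinuousLinearMap.adjoint (G k)) ((G k) (θ k - θhat k) + w k))‖
        ≤ ‖η - (θhat k + μ • (ContinuousLinearMap.adjoint (G k)) ((G k) (θ k - θhat k) + w k))‖) :
    ∀ T : ℕ, 1 ≤ T →
      (∑ k ∈ Finset.range T, ‖w k‖
          ≤ Real.sqrt T * Real.sqrt (∑ k ∈ Finset.range T, ‖w k‖ ^ 2)) ∧
      (∑ k ∈ Finset.range T, ‖(G k) (θ k - θhat k)‖
          ≤ Real.sqrt T * Real.sqrt (∑ k ∈ Finset.range T, ‖w k‖ ^ 2)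
            + Real.sqrt (T / μ) * ‖θhat 0 - θ 0‖
            + Real.sqrt (2 * T * c_θ / μ)
                * ∑ k ∈ Finset.range T, Real.sqrt ‖θ (k + 1) - θ k‖) := by
  have hhat : ∀ k, θhat k ∈ Θ := by
    intro k
    cases k with
    | zero => exact hθhat0
    | succ k => exact hmem k
  have step : ∀ k, ‖θ (k + 1) - θhat (k + 1)‖ ^ 2 ≤ ‖θ k - θhat k‖ ^ 2
      - μ * ‖(G k) (θ k - θhat k)‖ ^ 2 + μ * ‖w k‖ ^ 2 + 2 * c_θ * ‖θ (k + 1) - θ k‖ := by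
    intro k
    have h1 := proj_step_aux Θ hΘconv _ _ (θ k) (hmem k) (hθ k) (hproj k)
    have h2 := lms_step_aux (G k) μ hμ (hG k) (θ k - θhat k) (w k)
    rw [← sub_sub] at h1
    have h3 := hΘdiam _ (hθ (k + 1)) _ (hmem k)
    have h4 := hΘdiam _ (hθ k) _ (hmem k)
    have h5 : ‖θ (k + 1) - θhat (k + 1)‖ ≤ ‖θ (k + 1) - θ k‖ + ‖θ k - θhat (k + 1)‖ :=
      norm_sub_le_norm_sub_add_norm_sub _ _ _
    have n1 := norm_nonneg (θ (k + 1) - θhat (k + 1))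
    have n2 := norm_nonneg (θ k - θhat (k + 1))
    have n3 := norm_nonneg (θ (k + 1) - θ k)
    have h6 : ‖θ (k + 1) - θhat (k + 1)‖ ^ 2 - ‖θ k - θhat (k + 1)‖ ^ 2
        ≤ 2 * c_θ * ‖θ (k + 1) - θ k‖ := by
      nlinarith [mul_nonneg (add_nonneg n1 n2) (sub_nonneg.2 h5),
        mul_nonneg n3 (sub_nonneg.2 (add_le_add h3 h4))]
    linarith
  have total : ∀ T : ℕ, ‖θ T - θhat T‖ ^ 2
      + μ * ∑ k ∈ Finset.range T, ‖(G k) (θ k - θhat k)‖ ^ 2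
      ≤ ‖θhat 0 - θ 0‖ ^ 2 + μ * ∑ k ∈ Finset.range T, ‖w k‖ ^ 2
        + 2 * c_θ * ∑ k ∈ Finset.range T, ‖θ (k + 1) - θ k‖ := by
    intro T
    induction T with
    | zero => simp [norm_sub_rev]
    | succ T ih =>
      simp only [Finset.sum_range_succ, mul_add]
      linarith [step T]
  intro T hT
  refine ⟨sum_le_sqrt_aux T _, (sum_le_sqrt_aux T _).trans ?_⟩
  have hsq : ∑ k ∈ Finset.range T, ‖θ (k + 1) - θ k‖
      ≤ (∑ k ∈ Finset.range T, Real.sqrt ‖θ (k + 1) - θ k‖) ^ 2 := by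
    have := Finset.sum_sq_le_sq_sum_of_nonneg (s := Finset.range T)
      (f := fun k => Real.sqrt ‖θ (k + 1) - θ k‖) (fun k _ => Real.sqrt_nonneg _)
    simpa [Real.sq_sqrt] using this
  have hW : 0 ≤ ∑ k ∈ Finset.range T, ‖w k‖ ^ 2 := Finset.sum_nonneg fun _ _ => sq_nonneg _
  have hS : 0 ≤ ∑ k ∈ Finset.range T, Real.sqrt ‖θ (k + 1) - θ k‖ :=
    Finset.sum_nonneg fun _ _ => Real.sqrt_nonneg _
  have tot := total T
  have hT0 : (0 : ℝ) ≤ T := Nat.cast_nonneg T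
  have he := sq_nonneg ‖θ T - θhat T‖
  generalize (∑ k ∈ Finset.range T, Real.sqrt ‖θ (k + 1) - θ k‖) = S at *
  generalize (∑ k ∈ Finset.range T, ‖w k‖ ^ 2) = W at *
  generalize (∑ k ∈ Finset.range T, ‖(G k) (θ k - θhat k)‖ ^ 2) = X at *
  generalize (∑ k ∈ Finset.range T, ‖θ (k + 1) - θ k‖) = D at *
  have hn := norm_nonneg (θhat 0 - θ 0)
  generalize ‖θhat 0 - θ 0‖ = e at *
  rw [← Real.sqrt_mul hT0]
  apply Real.sqrt_le_iff.2
  have hA : 0 ≤ Real.sqrt T * Real.sqrt W := by positivity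
  have hB : 0 ≤ Real.sqrt (T / μ) * e := by positivity
  have hC : 0 ≤ Real.sqrt (2 * T * c_θ / μ) * S := by positivity
  have hA2 : (Real.sqrt T * Real.sqrt W) ^ 2 = T * W := by
    rw [mul_pow, Real.sq_sqrt hT0, Real.sq_sqrt hW]
  have hB2 : (Real.sqrt (T / μ) * e) ^ 2 = T / μ * e ^ 2 := by
    rw [mul_pow, Real.sq_sqrt (by positivity)]
  have hC2 : (Real.sqrt (2 * T * c_θ / μ) * S) ^ 2 = 2 * T * c_θ / μ * S ^ 2 := by
    rw [mul_pow, Real.sq_sqrt (by positivity)]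
  refine ⟨by positivity, ?_⟩
  have hX : X ≤ (e ^ 2 + μ * W + 2 * c_θ * S ^ 2) / μ := by
    rw [le_div_iff₀ hμ]
    nlinarith [mul_le_mul_of_nonneg_left hsq hcθ]
  have hTX : T * X ≤ T * W + T / μ * e ^ 2 + 2 * T * c_θ / μ * S ^ 2 := by
    calc T * X ≤ T * ((e ^ 2 + μ * W + 2 * c_θ * S ^ 2) / μ) :=
          mul_le_mul_of_nonneg_left hX hT0
      _ = _ := by field_simp; ring
  rw [← hA2, ← hB2, ← hC2] at hTX
  nlinarith [mul_nonneg hA hB, mul_nonneg hA hC, mul_nonneg hB hC]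
end

section
/- (Proposition 3: distance of consecutive state predictions.) In the Lipschitz prediction setup, fix N ∈ ℕ, reference sequences z : ℕ → X and v : ℕ → U, parameters θ̂, θ̂' ∈ Pθ, and δ ≥ 0 with ‖θ̂' − θ̂‖ ≤ √μ·δ. Let b : ℕ → X satisfy b (j+1) = f (b j) (κ (b j) (z j) (v j)) θ̂ for all j with 0 ≤ j ≤ N, and let a : ℕ → X satisfy ‖a 0 − b 1‖ ≤ δ and a j = f (a (j−1)) (κ (a (j−1)) (z j) (v j)) θ̂' for all j with 1 ≤ j ≤ N. Then for every j with 1 ≤ j ≤ N+1: ‖a (j−1) − b j‖ ≤ (∑_{i=0}^{j−1} (L_dyn·(1+L_κ))^i)·δ; in particular ‖a (j−1) − b j‖ ≤ C_{dyn,κ}·δ with C_{dyn,κ} := ∑_{i=0}^{N} (L_dyn·(1+L_κ))^i. -/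
/-- Proposition 3: distance of consecutive state predictions. -/
theorem distance_of_consecutive_state_predictions
    (n_x n_u n_θ : ℕ) (hnx : 1 ≤ n_x) (hnu : 1 ≤ n_u) (hnθ : 1 ≤ n_θ)
    (μ : ℝ) (hμ : 0 < μ)
    (L_dyn L_κ : ℝ) (hLdyn : 0 ≤ L_dyn) (hLκ : 0 ≤ L_κ)
    (f₀ : EuclideanSpace ℝ (Fin n_x) → EuclideanSpace ℝ (Fin n_u) → EuclideanSpace ℝ (Fin n_x))
    (G : EuclideanSpace ℝ (Fin n_x) → EuclideanSpace ℝ (Fin n_u) →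
      (EuclideanSpace ℝ (Fin n_θ) →L[ℝ] EuclideanSpace ℝ (Fin n_x)))
    (hG : ∀ x u, μ * ‖G x u‖ ^ 2 ≤ 1)
    (f : EuclideanSpace ℝ (Fin n_x) → EuclideanSpace ℝ (Fin n_u) →
      EuclideanSpace ℝ (Fin n_θ) → EuclideanSpace ℝ (Fin n_x))
    (hf : ∀ x u ϑ, f x u ϑ = f₀ x u + (G x u) ϑ)
    (hLip : ∀ ϑ x x' u u', ‖f x u ϑ - f x' u' ϑ‖ ≤ L_dyn * (‖x - x'‖ + ‖u - u'‖))
    (κ : EuclideanSpace ℝ (Fin n_x) → EuclideanSpace ℝ (Fin n_x) →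
      EuclideanSpace ℝ (Fin n_u) → EuclideanSpace ℝ (Fin n_u))
    (hκ : ∀ x x' z v, ‖κ x z v - κ x' z v‖ ≤ L_κ * ‖x - x'‖)
    (N : ℕ) (z : ℕ → EuclideanSpace ℝ (Fin n_x)) (v : ℕ → EuclideanSpace ℝ (Fin n_u))
    (θhat θhat' : EuclideanSpace ℝ (Fin n_θ)) (δ : ℝ) (hδ : 0 ≤ δ)
    (hθdiff : ‖θhat' - θhat‖ ≤ Real.sqrt μ * δ)
    (b a : ℕ → EuclideanSpace ℝ (Fin n_x))
    (hb : ∀ j : ℕ, j ≤ N → b (j + 1) = f (b j) (κ (b j) (z j) (v j)) θhat)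
    (ha0 : ‖a 0 - b 1‖ ≤ δ)
    (ha : ∀ j : ℕ, 1 ≤ j → j ≤ N → a j = f (a (j - 1)) (κ (a (j - 1)) (z j) (v j)) θhat') :
    ∀ j : ℕ, 1 ≤ j → j ≤ N + 1 →
      ‖a (j - 1) - b j‖ ≤ (∑ i ∈ Finset.range j, (L_dyn * (1 + L_κ)) ^ i) * δ ∧
      ‖a (j - 1) - b j‖ ≤ (∑ i ∈ Finset.range (N + 1), (L_dyn * (1 + L_κ)) ^ i) * δ := by
  have hGδ : ∀ x u, ‖G x u (θhat' - θhat)‖ ≤ δ := by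
    intro x u
    have h1 : Real.sqrt μ * ‖G x u‖ ≤ 1 := by
      have h2 : (Real.sqrt μ * ‖G x u‖) ^ 2 ≤ 1 := by
        rw [mul_pow, Real.sq_sqrt hμ.le]
        exact hG x u
      have h3 : 0 ≤ Real.sqrt μ * ‖G x u‖ := by positivity
      nlinarith
    calc ‖G x u (θhat' - θhat)‖ ≤ ‖G x u‖ * ‖θhat' - θhat‖ := (G x u).le_opNorm _
      _ ≤ ‖G x u‖ * (Real.sqrt μ * δ) := by gcongr
      _ = (Real.sqrt μ * ‖G x u‖) * δ := by ring
      _ ≤ 1 * δ := by gcongr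
      _ = δ := one_mul δ
  have hρ : 0 ≤ L_dyn * (1 + L_κ) := by positivity
  have key : ∀ k : ℕ, k ≤ N →
      ‖a k - b (k + 1)‖ ≤ (∑ i ∈ Finset.range (k + 1), (L_dyn * (1 + L_κ)) ^ i) * δ := by
    intro k
    induction k with
    | zero => intro _; simpa using ha0
    | succ k ih =>
      intro hk
      have ih' := ih (by omega)
      have hak := ha (k + 1) (by omega) hk
      rw [Nat.add_sub_cancel] at hak
      have hbk := hb (k + 1) hk
      have hsplit : a (k + 1) - b (k + 1 + 1)
          = G (a k) (κ (a k) (z (k + 1)) (v (k + 1))) (θhat' - θhat)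
            + (f (a k) (κ (a k) (z (k + 1)) (v (k + 1))) θhat
              - f (b (k + 1)) (κ (b (k + 1)) (z (k + 1)) (v (k + 1))) θhat) := by
        rw [hak, hbk, hf (a k) _ θhat', hf (a k) _ θhat, map_sub]
        abel
      have e1 := hLip θhat (a k) (b (k + 1)) (κ (a k) (z (k + 1)) (v (k + 1)))
        (κ (b (k + 1)) (z (k + 1)) (v (k + 1)))
      have e2 := hκ (a k) (b (k + 1)) (z (k + 1)) (v (k + 1))
      rw [hsplit, geom_sum_succ]
      calc _ ≤ _ := norm_add_le _ _
        _ ≤ δ + L_dyn * (‖a k - b (k + 1)‖ + L_κ * ‖a k - b (k + 1)‖) :=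
          add_le_add (hGδ _ _) (e1.trans (by gcongr))
        _ = L_dyn * (1 + L_κ) * ‖a k - b (k + 1)‖ + δ := by ring
        _ ≤ L_dyn * (1 + L_κ)
            * ((∑ i ∈ Finset.range (k + 1), (L_dyn * (1 + L_κ)) ^ i) * δ) + δ := by gcongr
        _ = _ := by ring
  intro j hj1 hjN
  obtain ⟨k, rfl⟩ : ∃ k, j = k + 1 := ⟨j - 1, by omega⟩
  rw [Nat.add_sub_cancel]
  have h := key k (by omega)
  refine ⟨h, h.trans (mul_le_mul_of_nonneg_right ?_ hδ)⟩
  exact Finset.sum_le_sum_of_subset_of_nonneg (Finset.range_mono hjN)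
    (fun i _ _ => pow_nonneg hρ i)
end

section
/- (Quadratic Lyapunov decrease via contraction; inequality (60) in the proof of Proposition 2.) Let E = EuclideanSpace ℝ (Fin n), let s ⊆ E be convex, let F : E → E be continuously differentiable, and let P, Q : E →L[ℝ] E be self-adjoint with ⟪v, P v⟫ ≥ 0 and ⟪v, Q v⟫ ≥ 0 for all v ∈ E. Assume that for all y ∈ s and all v ∈ E: ⟪fderiv ℝ F y v, P (fderiv ℝ F y v)⟫ ≤ ⟪v, P v⟫ − ⟪v, Q v⟫. Then for all x, z ∈ s: ⟪F x − F z, P (F x − F z)⟫ ≤ ⟪x − z, P (x − z)⟫ − ⟪x − z, Q (x − z)⟫. -/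
open scoped RealInnerProductSpace

/-- Quadratic Lyapunov decrease via contraction (inequality (60) in the proof of
Proposition 2). -/
theorem quadratic_lyapunov_decrease_via_contraction
    (n : ℕ) (s : Set (EuclideanSpace ℝ (Fin n))) (hs : Convex ℝ s)
    (F : EuclideanSpace ℝ (Fin n) → EuclideanSpace ℝ (Fin n)) (hF : ContDiff ℝ 1 F)
    (P Q : EuclideanSpace ℝ (Fin n) →L[ℝ] EuclideanSpace ℝ (Fin n))
    (hPsa : ∀ u v : EuclideanSpace ℝ (Fin n), ⟪P u, v⟫ = ⟪u, P v⟫)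
    (hQsa : ∀ u v : EuclideanSpace ℝ (Fin n), ⟪Q u, v⟫ = ⟪u, Q v⟫)
    (hPpsd : ∀ v : EuclideanSpace ℝ (Fin n), 0 ≤ ⟪v, P v⟫)
    (hQpsd : ∀ v : EuclideanSpace ℝ (Fin n), 0 ≤ ⟪v, Q v⟫)
    (hcontr : ∀ y ∈ s, ∀ v : EuclideanSpace ℝ (Fin n),
      ⟪fderiv ℝ F y v, P (fderiv ℝ F y v)⟫ ≤ ⟪v, P v⟫ - ⟪v, Q v⟫) :
    ∀ x ∈ s, ∀ z ∈ s,
      ⟪F x - F z, P (F x - F z)⟫ ≤ ⟪x - z, P (x - z)⟫ - ⟪x - z, Q (x - z)⟫ := by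
  intro x hx z hz
  set w := F x - F z with hw
  have hg : ∀ t : ℝ, HasDerivAt (fun t : ℝ => ⟪F (z + t • (x - z)), P w⟫)
      ⟪fderiv ℝ F (z + t • (x - z)) (x - z), P w⟫ t := by
    intro t
    have h1 : HasDerivAt (fun t : ℝ => z + t • (x - z)) (x - z) t := by
      simpa using ((hasDerivAt_id t).smul_const (x - z)).const_add z
    have h2 := ((hF.differentiable one_ne_zero) (z + t • (x - z))).hasFDerivAt
    have h3 := h2.comp_hasDerivAt t h1
    simpa using h3.inner ℝ (hasDerivAt_const t (P w))
  obtain ⟨c, hc, hceq⟩ := exists_hasDerivAt_eq_slope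
    (fun t : ℝ => ⟪F (z + t • (x - z)), P w⟫) _ (zero_lt_one)
    (fun t _ => (hg t).continuousAt.continuousWithinAt) (fun t _ => hg t)
  have hmem : z + c • (x - z) ∈ s := hs.add_smul_sub_mem hz hx ⟨hc.1.le, hc.2.le⟩
  have hD := hcontr _ hmem (x - z)
  set d := fderiv ℝ F (z + c • (x - z)) (x - z) with hd
  have hA : ⟪d, P w⟫ = ⟪w, P w⟫ := by
    rw [hceq]
    simp [hw, inner_sub_left]
  have hp := hPpsd (d - w)
  have hsym : ⟪w, P d⟫ = ⟪d, P w⟫ := by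
    rw [← hPsa, real_inner_comm]
  rw [map_sub, inner_sub_left, inner_sub_right, inner_sub_right, hsym] at hp
  linarith
end

section
/- (Terminal cost decrease; Proposition 2, for a fixed parameter and setpoint.) Let E = EuclideanSpace ℝ (Fin n) with n ≥ 1 and let s ⊆ E be convex. Let F : E → E (the closed-loop map) and ℓ̄ : E → ℝ (the shifted stage cost) be twice continuously differentiable, and let x̂ ∈ s satisfy F x̂ = x̂ and ℓ̄ x̂ = 0. Set A := fderiv ℝ F x̂ and suppose p ∈ E satisfies p − A.adjoint p = gradient ℓ̄ x̂. Let H ≥ 0 satisfy, for every coordinate i : Fin n, every y ∈ s and every v ∈ E: |(fderiv ℝ (fderiv ℝ (fun x => F x i)) y v) v| ≤ H·‖v‖². Let α ≥ (√n·H/2)·‖p‖. Let Q : E →L[ℝ] E be self-adjoint with ⟪v, Q v⟫ ≥ (fderiv ℝ (fderiv ℝ ℓ̄) y v) v + α·‖v‖² for all y ∈ s and v ∈ E, and with ⟪v, Q v⟫ ≥ α·‖v‖² for all v ∈ E. Let P : E →L[ℝ] E be self-adjoint with ⟪v, P v⟫ ≥ 0 for all v, such that ⟪fderiv ℝ F y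 v, P (fderiv ℝ F y v)⟫ ≤ ⟪v, P v⟫ − ⟪v, Q v⟫ for all y ∈ s and v ∈ E. Define the terminal cost ℓ_f x := ⟪x − x̂, P (x − x̂)⟫ + ⟪p, x − x̂⟫. Then for every x ∈ s: ℓ_f (F x) − ℓ_f x ≤ −ℓ̄ x. -/
open scoped RealInnerProductSpace

lemma taylor2_seg {V : Type*} [NormedAddCommGroup V] [NormedSpace ℝ V]
    {f : V → ℝ} (hf : ContDiff ℝ 2 f) {s : Set V} (hs : Convex ℝ s) {a x : V}
    (ha : a ∈ s) (hx : x ∈ s) :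
    ∃ y ∈ s, f x = f a + fderiv ℝ f a (x - a)
      + (fderiv ℝ (fderiv ℝ f) y (x - a)) (x - a) / 2 := by
  set d := x - a with hd
  have hmem : ∀ t : ℝ, 0 ≤ t → t ≤ 1 → a + t • d ∈ s := fun t h0 h1 =>
    hs.add_smul_sub_mem ha hx ⟨h0, h1⟩
  have hline : ∀ t : ℝ, HasDerivAt (fun t : ℝ => a + t • d) d t := by
    intro t
    simpa using ((hasDerivAt_id t).smul_const d).const_add a
  have hf1 : Differentiable ℝ f := hf.differentiable (by norm_num)
  have hf2 : Differentiable ℝ (fderiv ℝ f) :=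
    (hf.fderiv_right (m := 1) (by norm_num)).differentiable (by norm_num)
  have hg : ∀ t : ℝ, HasDerivAt (fun t : ℝ => f (a + t • d)) (fderiv ℝ f (a + t • d) d) t :=
    fun t => (hf1 _).hasFDerivAt.comp_hasDerivAt t (hline t)
  have hg' : ∀ t : ℝ, HasDerivAt (fun t : ℝ => fderiv ℝ f (a + t • d) d)
      (fderiv ℝ (fderiv ℝ f) (a + t • d) d d) t := by
    intro t
    have h1 := (hf2 (a + t • d)).hasFDerivAt.comp_hasDerivAt t (hline t)
    simpa using h1.clm_apply (hasDerivAt_const t d)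
  set C : ℝ := 2 * (f x - f a - fderiv ℝ f a d) with hC
  have hh : ∀ t : ℝ, HasDerivAt
      (fun t : ℝ => f (a + t • d) - t * fderiv ℝ f a d - C / 2 * t ^ 2)
      (fderiv ℝ f (a + t • d) d - fderiv ℝ f a d - C * t) t := by
    intro t
    have h2 := (((hg t).sub ((hasDerivAt_id t).mul_const (fderiv ℝ f a d))).sub
      ((hasDerivAt_pow 2 t).const_mul (C / 2)))
    refine h2.congr_deriv ?_
    simp
    ring
  obtain ⟨ξ, hξ, e1⟩ := exists_hasDerivAt_eq_slope _ _ (zero_lt_one' ℝ)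
    (fun t _ => (hh t).continuousAt.continuousWithinAt) (fun t _ => hh t)
  obtain ⟨η, hη, e2⟩ := exists_hasDerivAt_eq_slope _ _ hξ.1
    (fun t _ => (hg' t).continuousAt.continuousWithinAt) (fun t _ => hg' t)
  refine ⟨_, hmem η hη.1.le (hη.2.trans hξ.2).le, ?_⟩
  have hax : a + d = x := by simp [hd]
  simp [hax] at e1
  have e3 : fderiv ℝ f (a + ξ • d) d - fderiv ℝ f a d = C * ξ := by
    rw [sub_eq_iff_eq_add] at e1
    linarith
  have hξ0 := hξ.1.ne'
  simp [e3] at e2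
  rw [e2]
  field_simp
  rw [hC]; ring

/-- Terminal cost decrease (Proposition 2, for a fixed parameter and setpoint):
the linear-quadratic terminal cost `ℓ_f x = ⟪x − x̂, P (x − x̂)⟫ + ⟪p, x − x̂⟫`
decreases by at least the shifted stage cost along the closed-loop map `F`. -/
theorem terminal_cost_decrease
    (n : ℕ) (hn : 1 ≤ n)
    (s : Set (EuclideanSpace ℝ (Fin n))) (hs : Convex ℝ s)
    (F : EuclideanSpace ℝ (Fin n) → EuclideanSpace ℝ (Fin n))
    (lbar : EuclideanSpace ℝ (Fin n) → ℝ)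
    (hF : ContDiff ℝ 2 F) (hlbar : ContDiff ℝ 2 lbar)
    (xhat : EuclideanSpace ℝ (Fin n)) (hxhat : xhat ∈ s)
    (hfix : F xhat = xhat) (hl0 : lbar xhat = 0)
    (p : EuclideanSpace ℝ (Fin n))
    (hp : p - (ContinuousLinearMap.adjoint (fderiv ℝ F xhat)) p = gradient lbar xhat)
    (H : ℝ) (hH : 0 ≤ H)
    (hHessF : ∀ i : Fin n, ∀ y ∈ s, ∀ v : EuclideanSpace ℝ (Fin n),
      |(fderiv ℝ (fderiv ℝ (fun x => F x i)) y v) v| ≤ H * ‖v‖ ^ 2)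
    (α : ℝ) (hα : Real.sqrt n * H / 2 * ‖p‖ ≤ α)
    (Q : EuclideanSpace ℝ (Fin n) →L[ℝ] EuclideanSpace ℝ (Fin n))
    (hQsa : ∀ u v : EuclideanSpace ℝ (Fin n), ⟪Q u, v⟫ = ⟪u, Q v⟫)
    (hQl : ∀ y ∈ s, ∀ v : EuclideanSpace ℝ (Fin n),
      (fderiv ℝ (fderiv ℝ lbar) y v) v + α * ‖v‖ ^ 2 ≤ ⟪v, Q v⟫)
    (hQα : ∀ v : EuclideanSpace ℝ (Fin n), α * ‖v‖ ^ 2 ≤ ⟪v, Q v⟫)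
    (P : EuclideanSpace ℝ (Fin n) →L[ℝ] EuclideanSpace ℝ (Fin n))
    (hPsa : ∀ u v : EuclideanSpace ℝ (Fin n), ⟪P u, v⟫ = ⟪u, P v⟫)
    (hPpsd : ∀ v : EuclideanSpace ℝ (Fin n), 0 ≤ ⟪v, P v⟫)
    (hcontr : ∀ y ∈ s, ∀ v : EuclideanSpace ℝ (Fin n),
      ⟪fderiv ℝ F y v, P (fderiv ℝ F y v)⟫ ≤ ⟪v, P v⟫ - ⟪v, Q v⟫) :
    ∀ x ∈ s,
      (⟪F x - xhat, P (F x - xhat)⟫ + ⟪p, F x - xhat⟫)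
          - (⟪x - xhat, P (x - xhat)⟫ + ⟪p, x - xhat⟫)
        ≤ -lbar x := by
  intro x hx
  set d := x - xhat with hd
  set w := F x - xhat with hw
  have hF1 : Differentiable ℝ F := hF.differentiable (by norm_num)
  -- quadratic part
  have hquad : ⟪w, P w⟫ ≤ ⟪d, P d⟫ - ⟪d, Q d⟫ := by
    have hline : ∀ t : ℝ, HasDerivAt (fun t : ℝ => xhat + t • d) d t := by
      intro t
      simpa using ((hasDerivAt_id t).smul_const d).const_add xhat
    have hg : ∀ t : ℝ, HasDerivAt (fun t : ℝ => ⟪F (xhat + t • d), P w⟫)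
        ⟪fderiv ℝ F (xhat + t • d) d, P w⟫ t := by
      intro t
      have h1 := (hF1 (xhat + t • d)).hasFDerivAt.comp_hasDerivAt t (hline t)
      simpa using h1.inner ℝ (hasDerivAt_const t (P w))
    obtain ⟨ξ, hξ, e1⟩ := exists_hasDerivAt_eq_slope _ _ (zero_lt_one' ℝ)
      (fun t _ => (hg t).continuousAt.continuousWithinAt) (fun t _ => hg t)
    have hax : xhat + d = x := by simp [hd]
    have e2 : ⟪fderiv ℝ F (xhat + ξ • d) d, P w⟫ = ⟪w, P w⟫ := by
      rw [e1]
      simp only [one_smul, zero_smul, add_zero, hax, hfix, sub_zero, div_one]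
      rw [← inner_sub_left]
    have hy : xhat + ξ • d ∈ s := hs.add_smul_sub_mem hxhat hx ⟨hξ.1.le, hξ.2.le⟩
    have h3 := hcontr _ hy d
    set u := fderiv ℝ F (xhat + ξ • d) d
    have h4 := hPpsd (u - w)
    have h5 : ⟪w, P u⟫ = ⟪u, P w⟫ := by rw [← hPsa, real_inner_comm]
    simp only [map_sub, inner_sub_left, inner_sub_right] at h4
    linarith
  -- stage cost
  obtain ⟨y, hy, ey⟩ := taylor2_seg hlbar hs hxhat hx
  have hl := hQl y hy d
  have hgrad : fderiv ℝ lbar xhat d = ⟪p, d⟫ - ⟪p, fderiv ℝ F xhat d⟫ := by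
    have : fderiv ℝ lbar xhat d = ⟪gradient lbar xhat, d⟫ := by
      simp [gradient]
    rw [this, ← hp, inner_sub_left, ContinuousLinearMap.adjoint_inner_left]
  -- remainder
  set r := w - fderiv ℝ F xhat d with hr
  have hri : ∀ i, |r i| ≤ H / 2 * ‖d‖ ^ 2 := by
    intro i
    have hFi : ContDiff ℝ 2 (fun x => F x i) := (contDiff_euclidean.1 hF) i
    obtain ⟨z, hz, ez⟩ := taylor2_seg hFi hs hxhat hx
    have hb := hHessF i z hz d
    have hfd : fderiv ℝ (fun x => F x i) xhat d = (fderiv ℝ F xhat d) i := by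
      have := ((EuclideanSpace.proj (𝕜 := ℝ) i).hasFDerivAt.comp xhat
        (hF1 xhat).hasFDerivAt).fderiv
      exact congrArg (fun L => L d) this
    have : r i = (fderiv ℝ (fderiv ℝ (fun x => F x i)) z d) d / 2 := by
      rw [← hd, hfd, hfix] at ez
      simp only [hr, hw, PiLp.sub_apply]
      linarith
    rw [this, abs_div, abs_two]
    linarith
  have hrn : ‖r‖ ≤ Real.sqrt n * (H / 2 * ‖d‖ ^ 2) := by
    rw [EuclideanSpace.norm_eq]
    have hc : 0 ≤ H / 2 * ‖d‖ ^ 2 := by positivity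
    rw [← Real.sqrt_sq hc, ← Real.sqrt_mul (Nat.cast_nonneg n)]
    apply Real.sqrt_le_sqrt
    calc ∑ i, ‖r i‖ ^ 2 ≤ ∑ _i : Fin n, (H / 2 * ‖d‖ ^ 2) ^ 2 :=
          Finset.sum_le_sum fun i _ => by
            rw [Real.norm_eq_abs]
            exact pow_le_pow_left₀ (abs_nonneg _) (hri i) 2
      _ = _ := by simp
  have hpr : ⟪p, r⟫ ≤ α * ‖d‖ ^ 2 := by
    calc ⟪p, r⟫ ≤ ‖p‖ * ‖r‖ := real_inner_le_norm _ _
      _ ≤ ‖p‖ * (Real.sqrt n * (H / 2 * ‖d‖ ^ 2)) := by gcongr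
      _ = (Real.sqrt n * H / 2 * ‖p‖) * ‖d‖ ^ 2 := by ring
      _ ≤ _ := by gcongr
  have hq := hQα d
  have hpw : ⟪p, r⟫ = ⟪p, w⟫ - ⟪p, fderiv ℝ F xhat d⟫ := by rw [hr, inner_sub_right]
  rw [← hd, hgrad, hl0] at ey
  linarith
end

section
/- (Lemma 4: limits of series.) Let a : ℕ → ℝ and suppose there exist constants a_max ≥ 0 and S ≥ 0 such that 0 ≤ a k ≤ a_max for all k and ∑_{k=0}^{T−1} a k ≤ S for all T ∈ ℕ. Let α : ℝ → ℝ be continuous on [0, ∞), strictly increasing on [0, ∞), with α 0 = 0 and α(t) → ∞ as t → ∞ (a class-K∞ function). Then lim_{T→∞} (1/T)·∑_{k=0}^{T−1} α (a k) = 0. -/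
/-- Lemma 4: limits of series. If a nonnegative bounded sequence has uniformly bounded partial
sums, then the Cesàro averages of its image under any class-K∞ function tend to zero. -/
theorem cesaro_average_of_classKinf_tends_to_zero
    (a : ℕ → ℝ) (a_max S : ℝ) (ha_max : 0 ≤ a_max) (hS : 0 ≤ S)
    (ha : ∀ k : ℕ, 0 ≤ a k ∧ a k ≤ a_max)
    (hsum : ∀ T : ℕ, ∑ k ∈ Finset.range T, a k ≤ S)
    (α : ℝ → ℝ)
    (hα_cont : ContinuousOn α (Set.Ici 0))
    (hα_mono : StrictMonoOn α (Set.Ici 0))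
    (hα_zero : α 0 = 0)
    (hα_inf : Filter.Tendsto α Filter.atTop Filter.atTop) :
    Filter.Tendsto (fun T : ℕ => (1 / (T : ℝ)) * ∑ k ∈ Finset.range T, α (a k))
      Filter.atTop (nhds 0) := by
  have h1 : Filter.Tendsto a Filter.atTop (nhds 0) :=
    (summable_of_sum_range_le (fun k => (ha k).1) hsum).tendsto_atTop_zero
  have h2 : Filter.Tendsto a Filter.atTop (nhdsWithin 0 (Set.Ici 0)) :=
    tendsto_nhdsWithin_iff.2 ⟨h1, Filter.Eventually.of_forall fun k => (ha k).1⟩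
  have h3 : Filter.Tendsto α (nhdsWithin 0 (Set.Ici 0)) (nhds 0) := by
    have h := hα_cont 0 (Set.mem_Ici.2 le_rfl)
    rw [ContinuousWithinAt, hα_zero] at h
    exact h
  have h4 := (h3.comp h2).cesaro
  simpa only [one_div, Function.comp_apply] using h4
end
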